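/- Let g = (1/4, …, 1/4, −3/4, −3/4, −3/4, −3/4) ∈ ℝ¹⁶ (twelve coordinates equal to 1/4 and four equal to −3/4), and let A₁₅⁺ ⊆ ℝ¹⁶ be the set of vectors x with ∑_i x_i = 0 such that x − k·g has all integer coordinates for some k ∈ {0, 1, 2, 3}. Then for every real y > 0, ∑_{x ∈ A₁₅⁺} e^{-π y ‖x‖²} = θ₃(y)¹⁵ − 30 θ₃(y)⁷ Δ₈(y), where θ₃(y) = ∑_{n ∈ ℤ} e^{-π y n²} and Δ₈(y) = (1/16) θ₂(y)⁴ θ₄(y)⁴ with θ₂(y) = ∑_{n ∈ ℤ} e^{-π y (n+1/2)²} and θ₄(y) = ∑_{n ∈ ℤ} (-1)^n e^{-π y n²}. -/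

import Mathlib

open Real

/-- θ₂ on the imaginary axis: θ₂(y) = ∑_{n ∈ ℤ} e^{-π y (n + 1/2)²}. -/
noncomputable def theta2 (y : ℝ) : ℝ := ∑' n : ℤ, Real.exp (-π * y * ((n : ℝ) + 1/2)^2)

/-- θ₃ on the imaginary axis: θ₃(y) = ∑_{n ∈ ℤ} e^{-π y n²}. -/
noncomputable def theta3 (y : ℝ) : ℝ := ∑' n : ℤ, Real.exp (-π * y * (n : ℝ)^2)

/-- θ₄ on the imaginary axis: θ₄(y) = ∑_{n ∈ ℤ} (-1)^n e^{-π y n²}. -/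
noncomputable def theta4 (y : ℝ) : ℝ := ∑' n : ℤ, (-1 : ℝ) ^ n * Real.exp (-π * y * (n : ℝ)^2)

/-- Δ₈ on the imaginary axis: Δ₈(y) = (1/16) θ₂(y)⁴ θ₄(y)⁴. -/
noncomputable def Delta8 (y : ℝ) : ℝ := (1/16 : ℝ) * theta2 y ^ 4 * theta4 y ^ 4

/-- The glue vector g = ((1/4)¹², (−3/4)⁴) ∈ ℝ¹⁶. -/
noncomputable def glueA15 : Fin 16 → ℝ := fun i => if (i : ℕ) < 12 then 1/4 else -3/4

/-- The lattice A₁₅⁺ ⊆ ℝ¹⁶: vectors x with coordinate sum 0 such that x − k·g is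
integral for some k ∈ {0, 1, 2, 3}. -/
def A15plus : Set (EuclideanSpace ℝ (Fin 16)) :=
  {x | (∑ i, x i) = 0 ∧
    ∃ k : Fin 4, ∀ i, ∃ m : ℤ, x i - ((k : ℕ) : ℝ) * glueA15 i = (m : ℝ)}

open scoped ENNReal

/-- Functions `ℤ → ℝ≥0∞`, with convolution as multiplication. -/
@[ext] structure ConvSeq where
  /-- The underlying function. -/
  toFun : ℤ → ℝ≥0∞

namespace ConvSeq

instance : CoeFun ConvSeq fun _ => ℤ → ℝ≥0∞ := ⟨toFun⟩

theorem ext_apply {f g : ConvSeq} (h : ∀ n, f n = g n) : f = g := ConvSeq.ext (funext h)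

noncomputable instance : Add ConvSeq := ⟨fun f g => ⟨fun n => f n + g n⟩⟩

instance : Zero ConvSeq := ⟨⟨fun _ => 0⟩⟩

theorem add_apply (f g : ConvSeq) (n : ℤ) : (f + g) n = f n + g n := rfl

theorem zero_apply (n : ℤ) : (0 : ConvSeq) n = 0 := rfl

noncomputable instance : Mul ConvSeq := ⟨fun f g => ⟨fun n => ∑' i : ℤ, f i * g (n - i)⟩⟩

theorem mul_apply (f g : ConvSeq) (n : ℤ) : (f * g) n = ∑' i : ℤ, f i * g (n - i) := rfl

noncomputable instance : One ConvSeq := ⟨⟨fun n => if n = 0 then 1 else 0⟩⟩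

theorem one_apply (n : ℤ) : (1 : ConvSeq) n = if n = 0 then 1 else 0 := rfl

protected theorem mul_comm (f g : ConvSeq) : f * g = g * f := by
  refine ext_apply fun n => ?_
  rw [mul_apply, mul_apply, ← (Equiv.subLeft n).tsum_eq]
  refine tsum_congr fun i => ?_
  simp [mul_comm]

protected theorem mul_assoc (f g h : ConvSeq) : f * g * h = f * (g * h) := by
  refine ext_apply fun n => ?_
  simp only [mul_apply, ← ENNReal.tsum_mul_left, ← ENNReal.tsum_mul_right]
  rw [ENNReal.tsum_comm]
  refine tsum_congr fun j => ?_
  rw [← (Equiv.addRight j).tsum_eq]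
  refine tsum_congr fun i => ?_
  simp [mul_assoc, sub_sub, add_comm]

protected theorem one_mul (f : ConvSeq) : 1 * f = f := by
  refine ext_apply fun n => ?_
  rw [mul_apply, tsum_eq_single 0 (fun i hi => by simp [one_apply, hi])]
  simp [one_apply]

protected theorem mul_add (f g h : ConvSeq) : f * (g + h) = f * g + f * h := by
  refine ext_apply fun n => ?_
  simp only [mul_apply, add_apply, mul_add, ENNReal.tsum_add]

protected theorem mul_zero (f : ConvSeq) : f * 0 = 0 := by
  refine ext_apply fun n => ?_
  simp [mul_apply, zero_apply]

noncomputable instance : CommSemiring ConvSeq where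
  add_assoc f g h := ext_apply fun _ => add_assoc _ _ _
  add_comm f g := ext_apply fun _ => add_comm _ _
  zero_add f := ext_apply fun _ => zero_add _
  add_zero f := ext_apply fun _ => add_zero _
  nsmul := nsmulRec
  mul_assoc := ConvSeq.mul_assoc
  mul_comm := ConvSeq.mul_comm
  one_mul := ConvSeq.one_mul
  mul_one f := by rw [ConvSeq.mul_comm, ConvSeq.one_mul]
  left_distrib := ConvSeq.mul_add
  right_distrib f g h := by
    rw [ConvSeq.mul_comm, ConvSeq.mul_add, ConvSeq.mul_comm h, ConvSeq.mul_comm h]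
  mul_zero := ConvSeq.mul_zero
  zero_mul f := by rw [ConvSeq.mul_comm, ConvSeq.mul_zero]

/-- The sequence with value `a` at `0` and vanishing elsewhere, as a ring homomorphism. -/
noncomputable def const : ℝ≥0∞ →+* ConvSeq where
  toFun a := ⟨fun n => if n = 0 then a else 0⟩
  map_one' := rfl
  map_zero' := by refine ext_apply fun n => ?_; simp [zero_apply]
  map_add' a b := by
    refine ext_apply fun n => ?_
    rw [add_apply]
    dsimp only
    split_ifs <;> simp
  map_mul' a b := by
    refine ext_apply fun n => ?_
    rw [mul_apply, tsum_eq_single 0 (fun i hi => by simp [hi])]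
    by_cases hn : n = 0 <;> simp [hn]

theorem const_apply (a : ℝ≥0∞) (n : ℤ) : const a n = if n = 0 then a else 0 := rfl

theorem const_mul_apply (a : ℝ≥0∞) (f : ConvSeq) (n : ℤ) : (const a * f) n = a * f n := by
  rw [mul_apply, tsum_eq_single 0 (fun i hi => by simp [const_apply, hi])]
  simp [const_apply]

/-- The total mass, as a ring homomorphism. -/
noncomputable def mass : ConvSeq →+* ℝ≥0∞ where
  toFun f := ∑' n : ℤ, f n
  map_one' := by simp [one_apply]
  map_zero' := by simp [zero_apply]
  map_add' f g := by simp only [add_apply, ENNReal.tsum_add]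
  map_mul' f g := by
    simp only [mul_apply]
    rw [ENNReal.tsum_comm, ← ENNReal.tsum_mul_right]
    refine tsum_congr fun i => ?_
    rw [ENNReal.tsum_mul_left, ← (Equiv.subRight i).tsum_eq g]
    simp

theorem mass_apply (f : ConvSeq) : mass f = ∑' n : ℤ, f n := rfl

theorem mass_const (a : ℝ≥0∞) : mass (const a) = a := by
  simp [mass_apply, const_apply]

theorem tsum_eq_tsum_two_mul (F : ℤ → ℝ≥0∞) (hF : ∀ j, F (2 * j + 1) = 0) :
    ∑' i, F i = ∑' j, F (2 * j) := by
  have hinj : Function.Injective fun j : ℤ => 2 * j := fun a b h => by simpa using h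
  refine (hinj.tsum_eq fun i hi => ?_).symm
  rcases Int.even_or_odd' i with ⟨j, rfl | rfl⟩
  · exact ⟨j, rfl⟩
  · exact absurd (hF j) hi

/-- Dilation of the index by `2`, as a ring homomorphism. -/
noncomputable def dilate : ConvSeq →+* ConvSeq where
  toFun f := ⟨fun n => if 2 ∣ n then f (n / 2) else 0⟩
  map_one' := by
    refine ext_apply fun n => ?_
    simp only [one_apply]
    split_ifs <;> first | rfl | omega
  map_zero' := by refine ext_apply fun n => ?_; simp [zero_apply]
  map_add' f g := by
    refine ext_apply fun n => ?_
    rw [add_apply]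
    dsimp only
    split_ifs <;> simp [add_apply]
  map_mul' f g := by
    refine ext_apply fun n => ?_
    rw [mul_apply, tsum_eq_tsum_two_mul]
    · dsimp only
      split_ifs with h
      · obtain ⟨k, rfl⟩ := h
        rw [mul_apply]
        refine tsum_congr fun j => ?_
        rw [← mul_sub]
        simp
      · symm
        refine ENNReal.tsum_eq_zero.2 fun j => ?_
        rw [if_neg (show ¬ 2 ∣ n - 2 * j by omega), mul_zero]
    · intro j
      dsimp only
      rw [if_neg (show ¬ (2 : ℤ) ∣ 2 * j + 1 by omega), zero_mul]

theorem dilate_apply (f : ConvSeq) (n : ℤ) : dilate f n = if 2 ∣ n then f (n / 2) else 0 := rfl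

theorem dilate_two_mul (f : ConvSeq) (n : ℤ) : dilate f (2 * n) = f n := by
  simp [dilate_apply]

theorem dilate_two_mul_add_one (f : ConvSeq) (n : ℤ) : dilate f (2 * n + 1) = 0 :=
  if_neg (by omega)

theorem dilate_zero (f : ConvSeq) : dilate f 0 = f 0 := dilate_two_mul f 0

theorem mass_dilate (f : ConvSeq) : mass (dilate f) = mass f := by
  rw [mass_apply, tsum_eq_tsum_two_mul _ (dilate_two_mul_add_one f), mass_apply]
  simp only [dilate_two_mul]

theorem pow_apply (f : ConvSeq) (n : ℕ) (s : ℤ) :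
    (f ^ n) s = ∑' m : Fin n → ℤ, if ∑ i, m i = s then ∏ i, f (m i) else 0 := by
  induction n generalizing s with
  | zero => simp [one_apply, eq_comm]
  | succ n ih =>
    rw [pow_succ', mul_apply, ← (Fin.consEquiv fun _ : Fin (n + 1) => ℤ).tsum_eq,
      ENNReal.tsum_prod']
    refine tsum_congr fun i => ?_
    rw [ih, ← ENNReal.tsum_mul_left]
    refine tsum_congr fun m => ?_
    simp only [Fin.consEquiv_apply, Fin.sum_univ_succ, Fin.prod_univ_succ, Fin.cons_zero,
      Fin.cons_succ, mul_ite, mul_zero]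
    exact if_congr (by omega) rfl rfl

/-- The sequence `f` vanishes outside the residue class of `a` modulo `4`. -/
def SuppMod (f : ConvSeq) (a : ℤ) : Prop := ∀ n, ¬ 4 ∣ n - a → f n = 0

theorem SuppMod.mul {f g : ConvSeq} {a b : ℤ} (hf : SuppMod f a) (hg : SuppMod g b) :
    SuppMod (f * g) (a + b) := by
  intro n hn
  rw [mul_apply]
  refine ENNReal.tsum_eq_zero.2 fun i => ?_
  by_cases h : 4 ∣ i - a
  · rw [hg (n - i) (by omega), mul_zero]
  · rw [hf i h, zero_mul]

theorem SuppMod.pow {f : ConvSeq} {a : ℤ} (hf : SuppMod f a) (k : ℕ) :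
    SuppMod (f ^ k) (k * a) := by
  induction k with
  | zero =>
    intro n hn
    rw [pow_zero, one_apply, if_neg]
    rintro rfl
    simp at hn
  | succ k ih =>
    rw [pow_succ, Nat.cast_succ, add_one_mul]
    exact ih.mul hf

end ConvSeq

open ConvSeq

/-- The Gaussian `m ↦ exp (-π y (m / 4)²)` restricted to the residue class of `c` modulo `4`. -/
noncomputable def gaussMod (y : ℝ) (c : ℤ) : ConvSeq :=
  ⟨fun m => if 4 ∣ m - c then ENNReal.ofReal (Real.exp (-π * y * ((m : ℝ) / 4) ^ 2)) else 0⟩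

/-- The theta constant `∑ exp (-π y (m / 4)²)` over `m` congruent to `c` modulo `4`. -/
noncomputable def thetaMod (y : ℝ) (c : ℤ) : ℝ≥0∞ := mass (gaussMod y c)

theorem gaussMod_suppMod (y : ℝ) (c : ℤ) : SuppMod (gaussMod y c) c := fun _ hn => if_neg hn

theorem gaussMod_add_four (y : ℝ) (c : ℤ) : gaussMod y (c + 4) = gaussMod y c := by
  refine ext_apply fun n => ?_
  exact if_congr (by omega) rfl rfl

theorem thetaMod_add_four (y : ℝ) (c : ℤ) : thetaMod y (c + 4) = thetaMod y c := by
  rw [thetaMod, gaussMod_add_four, thetaMod]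

theorem thetaMod_neg (y : ℝ) (c : ℤ) : thetaMod y (-c) = thetaMod y c := by
  rw [thetaMod, thetaMod, mass_apply, mass_apply, ← (Equiv.neg ℤ).tsum_eq]
  refine tsum_congr fun m => ?_
  refine if_congr ?_ ?_ rfl
  · simp only [Equiv.neg_apply]
    omega
  · simp [neg_div]

theorem gaussMod_mul (y : ℝ) (u v : ℤ) :
    gaussMod y (u + v) * gaussMod y (u - v) =
      dilate (const (thetaMod (2 * y) v) * gaussMod (2 * y) u +
        const (thetaMod (2 * y) (v + 2)) * gaussMod (2 * y) (u + 2)) := by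
  refine ext_apply fun n => ?_
  rcases Int.even_or_odd' n with ⟨k, rfl | rfl⟩
  · rw [dilate_two_mul, ConvSeq.add_apply, const_mul_apply, const_mul_apply, mul_apply,
      ← (Equiv.addLeft k).tsum_eq, thetaMod, thetaMod, mass_apply, mass_apply,
      ← ENNReal.tsum_mul_right, ← ENNReal.tsum_mul_right, ← ENNReal.tsum_add]
    refine tsum_congr fun j => ?_
    have hexp : ENNReal.ofReal (Real.exp (-π * y * (((k + j : ℤ) : ℝ) / 4) ^ 2)) *
        ENNReal.ofReal (Real.exp (-π * y * (((2 * k - (k + j) : ℤ) : ℝ) / 4) ^ 2)) =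
        ENNReal.ofReal (Real.exp (-π * (2 * y) * ((j : ℝ) / 4) ^ 2)) *
        ENNReal.ofReal (Real.exp (-π * (2 * y) * ((k : ℝ) / 4) ^ 2)) := by
      rw [← ENNReal.ofReal_mul (Real.exp_nonneg _), ← ENNReal.ofReal_mul (Real.exp_nonneg _),
        ← Real.exp_add, ← Real.exp_add]
      congr 2
      push_cast
      ring
    simp only [gaussMod, Equiv.coe_addLeft, ite_mul, mul_ite, zero_mul, mul_zero, hexp]
    split_ifs <;> first | omega | simp
  · rw [dilate_two_mul_add_one, mul_apply]
    refine ENNReal.tsum_eq_zero.2 fun i => ?_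
    by_cases h : 4 ∣ i - (u + v)
    · rw [gaussMod_suppMod y (u - v) _ (by omega), mul_zero]
    · rw [gaussMod_suppMod y (u + v) _ h, zero_mul]

theorem gaussMod_sq (y : ℝ) (c : ℤ) :
    gaussMod y c ^ 2 = dilate (const (thetaMod (2 * y) 0) * gaussMod (2 * y) c +
        const (thetaMod (2 * y) 2) * gaussMod (2 * y) (c + 2)) := by
  simpa [sq] using gaussMod_mul y c 0

theorem gaussMod_add_two_sq (y : ℝ) (c : ℤ) :
    gaussMod y (c + 2) ^ 2 = dilate (const (thetaMod (2 * y) 2) * gaussMod (2 * y) c +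
        const (thetaMod (2 * y) 0) * gaussMod (2 * y) (c + 2)) := by
  rw [gaussMod_sq, add_assoc c, show (2 : ℤ) + 2 = 4 by norm_num, gaussMod_add_four, add_comm]

theorem thetaMod_zero_sq (y : ℝ) :
    thetaMod y 0 ^ 2 = thetaMod (2 * y) 0 ^ 2 + thetaMod (2 * y) 2 ^ 2 := by
  have h := congrArg mass (gaussMod_sq y 0)
  rw [mass_dilate] at h
  simp only [map_pow, map_add, map_mul, mass_const] at h
  simpa [thetaMod, sq] using h

theorem thetaMod_two_sq (y : ℝ) :
    thetaMod y 2 ^ 2 = 2 * thetaMod (2 * y) 0 * thetaMod (2 * y) 2 := by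
  have h := congrArg mass (gaussMod_add_two_sq y 0)
  rw [mass_dilate] at h
  simp only [map_pow, map_add, map_mul, mass_const, zero_add] at h
  rw [thetaMod, h]
  simp only [thetaMod]
  ring

theorem thetaMod_two_mul (y : ℝ) (c : ℤ) :
    thetaMod y (2 * c) = thetaMod (4 * y) c + thetaMod (4 * y) (c + 2) := by
  have h : gaussMod y (2 * c) = dilate (gaussMod (4 * y) c + gaussMod (4 * y) (c + 2)) := by
    refine ext_apply fun n => ?_
    rcases Int.even_or_odd' n with ⟨k, rfl | rfl⟩
    · have hexp : -π * y * (((2 * k : ℤ) : ℝ) / 4) ^ 2 = -π * (4 * y) * ((k : ℝ) / 4) ^ 2 := by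
        push_cast
        ring
      rw [dilate_two_mul, ConvSeq.add_apply]
      simp only [gaussMod, hexp]
      split_ifs <;> first | omega | simp
    · rw [dilate_two_mul_add_one]
      exact if_neg (by omega)
  rw [thetaMod, h, mass_dilate, map_add]
  rfl

theorem thetaMod_zero_eq (y : ℝ) : thetaMod y 0 = thetaMod (4 * y) 0 + thetaMod (4 * y) 2 :=
  thetaMod_two_mul y 0

theorem thetaMod_two_eq (y : ℝ) : thetaMod y 2 = 2 * thetaMod (4 * y) 1 := by
  have h := thetaMod_two_mul y 1
  have h3 := thetaMod_add_four (4 * y) (-1)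
  rw [thetaMod_neg] at h3
  norm_num at h h3
  rw [h, h3, two_mul]

theorem gaussMod_pow_mul_pow_zero (y : ℝ) (c : ℤ) (j k : ℕ) (h : ¬ 4 ∣ j * c + k * (c + 2)) :
    (gaussMod y c ^ j * gaussMod y (c + 2) ^ k) 0 = 0 :=
  ((gaussMod_suppMod y c).pow j).mul ((gaussMod_suppMod y (c + 2)).pow k) 0 (by omega)

theorem quartic_apply_zero (y : ℝ) (c : ℤ) (p₀ p₁ p₂ p₃ p₄ : ℝ≥0∞) :
    (const p₀ * gaussMod y c ^ 4 + const p₁ * (gaussMod y c ^ 3 * gaussMod y (c + 2) ^ 1) +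
      const p₂ * (gaussMod y c ^ 2 * gaussMod y (c + 2) ^ 2) +
      const p₃ * (gaussMod y c ^ 1 * gaussMod y (c + 2) ^ 3) +
      const p₄ * gaussMod y (c + 2) ^ 4) 0 =
    p₀ * (gaussMod y c ^ 4) 0 + p₂ * (gaussMod y c ^ 2 * gaussMod y (c + 2) ^ 2) 0 +
      p₄ * (gaussMod y (c + 2) ^ 4) 0 := by
  simp only [ConvSeq.add_apply, const_mul_apply]
  rw [gaussMod_pow_mul_pow_zero y c 3 1 (by push_cast; omega),
    gaussMod_pow_mul_pow_zero y c 1 3 (by push_cast; omega)]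
  ring

theorem quadratic_apply_zero (y : ℝ) (c : ℤ) (p₀ p₁ p₂ : ℝ≥0∞) :
    (const p₀ * gaussMod y c ^ 2 + const p₁ * (gaussMod y c * gaussMod y (c + 2)) +
      const p₂ * gaussMod y (c + 2) ^ 2) 0 =
    p₀ * (gaussMod y c ^ 2) 0 + p₁ * (gaussMod y c * gaussMod y (c + 2)) 0 +
      p₂ * (gaussMod y (c + 2) ^ 2) 0 := by
  simp only [ConvSeq.add_apply, const_mul_apply]

theorem gaussMod_pow_four_zero (y : ℝ) (c : ℤ) :
    (gaussMod y c ^ 4) 0 =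
      thetaMod (2 * y) 0 ^ 2 * (gaussMod (2 * y) c ^ 2) 0 +
      2 * thetaMod (2 * y) 0 * thetaMod (2 * y) 2 *
        (gaussMod (2 * y) c * gaussMod (2 * y) (c + 2)) 0 +
      thetaMod (2 * y) 2 ^ 2 * (gaussMod (2 * y) (c + 2) ^ 2) 0 := by
  rw [show 4 = 2 * 2 from rfl, pow_mul, gaussMod_sq, ← map_pow, dilate_zero,
    ← quadratic_apply_zero]
  congr 1
  simp only [map_mul, map_pow, map_ofNat]
  ring

theorem gaussMod_sq_mul_sq_zero (y : ℝ) (c : ℤ) :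
    (gaussMod y c ^ 2 * gaussMod y (c + 2) ^ 2) 0 =
      thetaMod (2 * y) 0 * thetaMod (2 * y) 2 * (gaussMod (2 * y) c ^ 2) 0 +
      (thetaMod (2 * y) 0 ^ 2 + thetaMod (2 * y) 2 ^ 2) *
        (gaussMod (2 * y) c * gaussMod (2 * y) (c + 2)) 0 +
      thetaMod (2 * y) 0 * thetaMod (2 * y) 2 * (gaussMod (2 * y) (c + 2) ^ 2) 0 := by
  rw [gaussMod_sq, gaussMod_add_two_sq, ← map_mul, dilate_zero, ← quadratic_apply_zero]
  congr 1
  simp only [map_mul, map_pow, map_add]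
  ring

theorem gaussMod_pow_mul_pow_eq (y : ℝ) (c : ℤ) (j k : ℕ) :
    (gaussMod y c ^ (2 * j) * gaussMod y (c + 2) ^ (2 * k)) 0 =
      ((const (thetaMod (2 * y) 0) * gaussMod (2 * y) c +
        const (thetaMod (2 * y) 2) * gaussMod (2 * y) (c + 2)) ^ j *
       (const (thetaMod (2 * y) 2) * gaussMod (2 * y) c +
        const (thetaMod (2 * y) 0) * gaussMod (2 * y) (c + 2)) ^ k) 0 := by
  rw [pow_mul, pow_mul, gaussMod_sq, gaussMod_add_two_sq, ← map_pow, ← map_pow, ← map_mul,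
    dilate_zero]

theorem gaussMod_pow_eight_zero (y : ℝ) (c : ℤ) (s t : ℝ≥0∞) (hs : s = thetaMod (2 * y) 0)
    (ht : t = thetaMod (2 * y) 2) (α β γ : ℝ≥0∞) (hα : α = (gaussMod (2 * y) c ^ 4) 0)
    (hβ : β = (gaussMod (2 * y) c ^ 2 * gaussMod (2 * y) (c + 2) ^ 2) 0)
    (hγ : γ = (gaussMod (2 * y) (c + 2) ^ 4) 0) :
    (gaussMod y c ^ 8 * gaussMod y (c + 2) ^ 0) 0 =
      s ^ 4 * α + 6 * s ^ 2 * t ^ 2 * β + t ^ 4 * γ ∧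
    (gaussMod y c ^ 6 * gaussMod y (c + 2) ^ 2) 0 =
      s ^ 3 * t * α + (3 * s * t ^ 3 + 3 * s ^ 3 * t) * β + s * t ^ 3 * γ ∧
    (gaussMod y c ^ 4 * gaussMod y (c + 2) ^ 4) 0 =
      s ^ 2 * t ^ 2 * α + (s ^ 4 + 4 * s ^ 2 * t ^ 2 + t ^ 4) * β + s ^ 2 * t ^ 2 * γ ∧
    (gaussMod y c ^ 2 * gaussMod y (c + 2) ^ 6) 0 =
      s * t ^ 3 * α + (3 * s * t ^ 3 + 3 * s ^ 3 * t) * β + s ^ 3 * t * γ ∧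
    (gaussMod y c ^ 0 * gaussMod y (c + 2) ^ 8) 0 =
      t ^ 4 * α + 6 * s ^ 2 * t ^ 2 * β + s ^ 4 * γ := by
  refine ⟨?_, ?_, ?_, ?_, ?_⟩
  · rw [gaussMod_pow_mul_pow_eq y c 4 0, hα, hβ, hγ,
      ← quartic_apply_zero _ _ _ (4 * s ^ 3 * t) _ (4 * s * t ^ 3), hs, ht]
    congr 1
    simp only [map_mul, map_pow, map_ofNat]
    ring
  · rw [gaussMod_pow_mul_pow_eq y c 3 1, hα, hβ, hγ,
      ← quartic_apply_zero _ _ _ (s ^ 4 + 3 * s ^ 2 * t ^ 2) _ (3 * s ^ 2 * t ^ 2 + t ^ 4), hs, ht]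
    congr 1
    simp only [map_mul, map_pow, map_add, map_ofNat]
    ring
  · rw [gaussMod_pow_mul_pow_eq y c 2 2, hα, hβ, hγ,
      ← quartic_apply_zero _ _ _ (2 * s ^ 3 * t + 2 * s * t ^ 3) _
        (2 * s ^ 3 * t + 2 * s * t ^ 3), hs, ht]
    congr 1
    simp only [map_mul, map_pow, map_add, map_ofNat]
    ring
  · rw [gaussMod_pow_mul_pow_eq y c 1 3, hα, hβ, hγ,
      ← quartic_apply_zero _ _ _ (t ^ 4 + 3 * s ^ 2 * t ^ 2) _ (3 * s ^ 2 * t ^ 2 + s ^ 4), hs, ht]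
    congr 1
    simp only [map_mul, map_pow, map_add, map_ofNat]
    ring
  · rw [gaussMod_pow_mul_pow_eq y c 0 4, hα, hβ, hγ,
      ← quartic_apply_zero _ _ _ (4 * s * t ^ 3) _ (4 * s ^ 3 * t), hs, ht]
    congr 1
    simp only [map_mul, map_pow, map_ofNat]
    ring

theorem gaussMod_pow_sixteen_zero (y : ℝ) (c : ℤ) :
    (gaussMod y c ^ 16) 0 =
      thetaMod (2 * y) 0 ^ 8 * (gaussMod (2 * y) c ^ 8 * gaussMod (2 * y) (c + 2) ^ 0) 0 +
      28 * thetaMod (2 * y) 0 ^ 6 * thetaMod (2 * y) 2 ^ 2 *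
        (gaussMod (2 * y) c ^ 6 * gaussMod (2 * y) (c + 2) ^ 2) 0 +
      70 * thetaMod (2 * y) 0 ^ 4 * thetaMod (2 * y) 2 ^ 4 *
        (gaussMod (2 * y) c ^ 4 * gaussMod (2 * y) (c + 2) ^ 4) 0 +
      28 * thetaMod (2 * y) 0 ^ 2 * thetaMod (2 * y) 2 ^ 6 *
        (gaussMod (2 * y) c ^ 2 * gaussMod (2 * y) (c + 2) ^ 6) 0 +
      thetaMod (2 * y) 2 ^ 8 * (gaussMod (2 * y) c ^ 0 * gaussMod (2 * y) (c + 2) ^ 8) 0 := by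
  rw [show 16 = 2 * 8 from rfl, pow_mul, gaussMod_sq, ← map_pow, dilate_zero, add_pow]
  have hterm (j k n : ℕ) (a b : ℝ≥0∞) :
      ((const a * gaussMod (2 * y) c) ^ j * (const b * gaussMod (2 * y) (c + 2)) ^ k * n) 0 =
        n * a ^ j * b ^ k * (gaussMod (2 * y) c ^ j * gaussMod (2 * y) (c + 2) ^ k) 0 := by
    rw [← const_mul_apply]
    congr 1
    simp only [map_mul, map_pow, map_natCast]
    ring
  have hodd (j k : ℕ) (hk : k % 2 = 1) (hjk : j + k = 8) :
      (gaussMod (2 * y) c ^ j * gaussMod (2 * y) (c + 2) ^ k) 0 = 0 := by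
    refine gaussMod_pow_mul_pow_zero _ _ _ _ ?_
    obtain rfl : j = 8 - k := by omega
    have : k ≤ 8 := by omega
    interval_cases k <;> omega
  simp only [Finset.sum_range_succ, Finset.sum_range_zero, ConvSeq.add_apply, hterm,
    ConvSeq.zero_apply, Nat.reduceSub, Nat.reduceAdd,
    hodd 7 1 rfl rfl, hodd 5 3 rfl rfl, hodd 3 5 rfl rfl, hodd 1 7 rfl rfl]
  norm_num [Nat.choose]
  ring

theorem gaussMod_sq_zero (y : ℝ) (c : ℤ) :
    (gaussMod y c ^ 2) 0 = thetaMod (2 * y) 0 * gaussMod (2 * y) c 0 +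
      thetaMod (2 * y) 2 * gaussMod (2 * y) (c + 2) 0 := by
  rw [gaussMod_sq, dilate_zero, ConvSeq.add_apply, const_mul_apply, const_mul_apply]

theorem gaussMod_mul_add_two_zero (y : ℝ) (c : ℤ) :
    (gaussMod y c * gaussMod y (c + 2)) 0 =
      thetaMod (2 * y) 1 * (gaussMod (2 * y) (c + 1) 0 + gaussMod (2 * y) (c + 3) 0) := by
  have h := gaussMod_mul y (c + 1) (-1)
  rw [show c + 1 + -1 = c by ring, show c + 1 - -1 = c + 2 by ring, thetaMod_neg,
    show (-1 : ℤ) + 2 = 1 by norm_num, show c + 1 + 2 = c + 3 by ring] at h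
  rw [h, dilate_zero, ConvSeq.add_apply, const_mul_apply, const_mul_apply, mul_add]

theorem gaussMod_apply_zero (y : ℝ) (c : ℤ) : gaussMod y c 0 = if 4 ∣ c then 1 else 0 := by
  simp [gaussMod]

theorem thetaMod_zero_pow_three (y : ℝ) :
    thetaMod y 0 ^ 3 = (thetaMod (2 * y) 0 ^ 2 + thetaMod (2 * y) 2 ^ 2) *
      (thetaMod (4 * y) 0 + thetaMod (4 * y) 2) := by
  rw [← thetaMod_zero_sq, ← thetaMod_zero_eq, pow_succ]

theorem thetaMod_two_pow_three (y : ℝ) :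
    thetaMod y 2 ^ 3 = 4 * thetaMod (2 * y) 0 * thetaMod (2 * y) 2 * thetaMod (4 * y) 1 := by
  rw [pow_succ, thetaMod_two_sq, thetaMod_two_eq y]
  ring

theorem sum_gaussMod_pow_four_zero (y : ℝ) :
    ∑ k : Fin 4, (gaussMod y ((k : ℕ) : ℤ) ^ 4) 0 = thetaMod y 0 ^ 3 + thetaMod y 2 ^ 3 := by
  have h4 : 2 * (2 * y) = 4 * y := by ring
  simp only [gaussMod_pow_four_zero, gaussMod_sq_zero, gaussMod_mul_add_two_zero, h4,
    gaussMod_apply_zero, Fin.sum_univ_four]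
  norm_num
  rw [thetaMod_zero_pow_three, thetaMod_two_pow_three]
  ring

theorem sum_gaussMod_add_two_pow_four_zero (y : ℝ) :
    ∑ k : Fin 4, (gaussMod y (((k : ℕ) : ℤ) + 2) ^ 4) 0 =
      thetaMod y 0 ^ 3 + thetaMod y 2 ^ 3 := by
  rw [← sum_gaussMod_pow_four_zero]
  simp only [Fin.sum_univ_four]
  have h0 := gaussMod_add_four y 0
  have h1 := gaussMod_add_four y 1
  norm_num at h0 h1 ⊢
  rw [h0, h1]
  abel

theorem sum_gaussMod_sq_mul_sq_zero (y : ℝ) :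
    ∑ k : Fin 4, (gaussMod y ((k : ℕ) : ℤ) ^ 2 * gaussMod y (((k : ℕ) : ℤ) + 2) ^ 2) 0 =
      thetaMod y 0 ^ 2 * thetaMod y 2 + thetaMod y 0 * thetaMod y 2 ^ 2 := by
  have h4 : 2 * (2 * y) = 4 * y := by ring
  simp only [gaussMod_sq_mul_sq_zero, gaussMod_sq_zero, gaussMod_mul_add_two_zero, h4,
    gaussMod_apply_zero, Fin.sum_univ_four]
  norm_num
  rw [thetaMod_two_sq y, thetaMod_zero_sq y, thetaMod_two_eq y, thetaMod_zero_eq y]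
  ring

theorem sum_gaussMod_pow_sixteen_zero (y : ℝ) (s t : ℝ≥0∞) (hs : s = thetaMod (4 * y) 0)
    (ht : t = thetaMod (4 * y) 2) :
    ∑ k : Fin 4, (gaussMod y ((k : ℕ) : ℤ) ^ 16) 0 =
      ((s ^ 4 + t ^ 4) * (s ^ 3 + t ^ 3) + 6 * s ^ 2 * t ^ 2 * (s ^ 2 * t + s * t ^ 2)) *
        ((s ^ 2 + t ^ 2) ^ 4 + (2 * s * t) ^ 4) +
      28 * (s ^ 2 + t ^ 2) * (2 * s * t) * ((s ^ 2 + t ^ 2) ^ 2 + (2 * s * t) ^ 2) *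
        ((s ^ 3 * t + s * t ^ 3) * (s ^ 3 + t ^ 3) +
          3 * (s ^ 3 * t + s * t ^ 3) * (s ^ 2 * t + s * t ^ 2)) +
      70 * (s ^ 2 + t ^ 2) ^ 2 * (2 * s * t) ^ 2 * (2 * s ^ 2 * t ^ 2 * (s ^ 3 + t ^ 3) +
        (s ^ 4 + 4 * s ^ 2 * t ^ 2 + t ^ 4) * (s ^ 2 * t + s * t ^ 2)) := by
  have h4 : 2 * (2 * y) = 4 * y := by ring
  have hA := thetaMod_zero_sq (2 * y)
  have hB := thetaMod_two_sq (2 * y)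
  rw [h4, ← hs, ← ht] at hA hB
  have hα := sum_gaussMod_pow_four_zero (4 * y)
  have hγ := sum_gaussMod_add_two_pow_four_zero (4 * y)
  have hβ := sum_gaussMod_sq_mul_sq_zero (4 * y)
  rw [← hs, ← ht] at hα hβ hγ
  have key (c : ℤ) := gaussMod_pow_eight_zero (2 * y) c s t (by rw [h4, hs]) (by rw [h4, ht])
    _ _ _ rfl rfl rfl
  simp only [h4] at key
  have hpow (x : ℝ≥0∞) : x ^ 8 = (x ^ 2) ^ 4 ∧ x ^ 6 = (x ^ 2) ^ 3 ∧ x ^ 4 = (x ^ 2) ^ 2 := by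
    refine ⟨?_, ?_, ?_⟩ <;> ring
  simp only [gaussMod_pow_sixteen_zero, key, (hpow (thetaMod (2 * y) _)).1,
    (hpow (thetaMod (2 * y) _)).2.1, (hpow (thetaMod (2 * y) _)).2.2, hA, hB]
  simp only [Finset.sum_add_distrib, ← Finset.mul_sum, hα, hβ, hγ]
  ring

theorem summable_exp_neg_mul_int_add_sq (y : ℝ) (hy : 0 < y) (a : ℝ) :
    Summable fun n : ℤ => Real.exp (-π * y * ((n : ℝ) + a) ^ 2) := by
  refine (HurwitzKernelBounds.summable_f_int 0 a hy).congr fun n => ?_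
  simp only [HurwitzKernelBounds.f_int, pow_zero, one_mul]
  congr 1
  ring

theorem thetaMod_eq_tsum (y : ℝ) (c : ℤ) :
    thetaMod y c =
      ∑' n : ℤ, ENNReal.ofReal (Real.exp (-π * y * ((n : ℝ) + (c : ℝ) / 4) ^ 2)) := by
  have hinj : Function.Injective fun n : ℤ => 4 * n + c := fun a b h => by simpa using h
  rw [thetaMod, mass_apply, ← hinj.tsum_eq]
  · refine tsum_congr fun n => ?_
    simp only [gaussMod, add_sub_cancel_right, dvd_mul_right, if_true]
    congr 4
    push_cast
    ring
  · intro m hm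
    by_contra h
    refine hm (gaussMod_suppMod y c m fun ⟨k, hk⟩ => h ⟨k, ?_⟩)
    dsimp only
    omega

theorem thetaMod_ne_top (y : ℝ) (hy : 0 < y) (c : ℤ) : thetaMod y c ≠ ⊤ := by
  rw [thetaMod_eq_tsum]
  exact (summable_exp_neg_mul_int_add_sq y hy _).tsum_ofReal_ne_top

theorem thetaMod_toReal (y : ℝ) (c : ℤ) :
    (thetaMod y c).toReal = ∑' n : ℤ, Real.exp (-π * y * ((n : ℝ) + (c : ℝ) / 4) ^ 2) := by
  rw [thetaMod_eq_tsum, ENNReal.tsum_toReal_eq fun _ => ENNReal.ofReal_ne_top]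
  exact tsum_congr fun n => ENNReal.toReal_ofReal (Real.exp_nonneg _)

theorem theta3_eq (y : ℝ) : theta3 y = (thetaMod y 0).toReal := by
  rw [thetaMod_toReal, theta3]
  simp

theorem theta2_eq (y : ℝ) : theta2 y = (thetaMod y 2).toReal := by
  rw [thetaMod_toReal, theta2]
  norm_num

theorem theta3_eq_add (y : ℝ) (hy : 0 < y) : theta3 y = theta3 (4 * y) + theta2 (4 * y) := by
  rw [theta3_eq, theta3_eq, theta2_eq, thetaMod_zero_eq, ENNReal.toReal_add]
  all_goals exact thetaMod_ne_top _ (by positivity) _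

theorem theta4_eq_sub (y : ℝ) (hy : 0 < y) : theta4 y = theta3 (4 * y) - theta2 (4 * y) := by
  have h3 := (summable_exp_neg_mul_int_add_sq (4 * y) (by positivity) 0).hasSum
  have h2 := (summable_exp_neg_mul_int_add_sq (4 * y) (by positivity) (1 / 2)).hasSum
  have hc : IsCompl (Set.range fun n : ℤ => 2 * n) (Set.range fun n : ℤ => 2 * n + 1) := by
    refine isCompl_iff.2 ⟨Set.disjoint_left.2 ?_, codisjoint_iff.2 (Set.eq_univ_of_forall ?_)⟩
    · rintro _ ⟨a, rfl⟩ ⟨b, hb⟩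
      dsimp only at hb
      omega
    · intro n
      obtain ⟨a, ha | ha⟩ := Int.even_or_odd' n
      exacts [Or.inl ⟨a, ha.symm⟩, Or.inr ⟨a, ha.symm⟩]
  have he : Function.Injective fun n : ℤ => 2 * n := fun a b h => by simpa using h
  have ho : Function.Injective fun n : ℤ => 2 * n + 1 := fun a b h => by simpa using h
  rw [theta4, theta3, theta2, sub_eq_add_neg]
  refine (HasSum.add_isCompl hc (he.hasSum_range_iff.2 ?_) (ho.hasSum_range_iff.2 ?_)).tsum_eq
  · simp only [add_zero] at h3
    convert h3 using 1
    funext n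
    simp only [Function.comp_apply, (even_two_mul n).neg_one_zpow, one_mul]
    congr 1
    push_cast
    ring
  · refine h2.neg.congr_fun fun n => ?_
    simp only [Function.comp_apply, (odd_two_mul_add_one n).neg_one_zpow, neg_one_mul]
    congr 2
    push_cast
    ring

theorem theta2_sq (y : ℝ) : theta2 y ^ 2 = 2 * theta3 (2 * y) * theta2 (2 * y) := by
  rw [theta2_eq, theta2_eq, theta3_eq, ← ENNReal.toReal_pow, thetaMod_two_sq]
  simp

theorem theta3_sq (y : ℝ) (hy : 0 < y) :
    theta3 y ^ 2 = theta3 (2 * y) ^ 2 + theta2 (2 * y) ^ 2 := by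
  rw [theta3_eq, theta3_eq, theta2_eq, ← ENNReal.toReal_pow, thetaMod_zero_sq, ENNReal.toReal_add]
  · simp
  all_goals exact ENNReal.pow_ne_top (thetaMod_ne_top _ (by positivity) _)

/-- The embedding of `ℤ¹⁶` in `ℝ¹⁶` scaled by `1 / 4`. -/
noncomputable def quarterEmb (m : Fin 16 → ℤ) : EuclideanSpace ℝ (Fin 16) :=
  WithLp.toLp 2 fun i => (m i : ℝ) / 4

theorem quarterEmb_apply (m : Fin 16 → ℤ) (i : Fin 16) : quarterEmb m i = (m i : ℝ) / 4 := rfl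

theorem quarterEmb_injective : Function.Injective quarterEmb := by
  intro m n h
  funext i
  have := congrArg (fun x : EuclideanSpace ℝ (Fin 16) => x i) h
  simp only [quarterEmb_apply] at this
  exact_mod_cast (div_left_inj' (by norm_num : (4 : ℝ) ≠ 0)).1 this

theorem A15plus_subset_range : A15plus ⊆ Set.range quarterEmb := by
  rintro x ⟨-, k, hk⟩
  choose m hm using hk
  refine ⟨fun i => 4 * m i + if (i : ℕ) < 12 then ((k : ℕ) : ℤ) else -3 * ((k : ℕ) : ℤ), ?_⟩
  ext i
  have h := hm i
  rw [quarterEmb_apply]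
  unfold glueA15 at h
  split_ifs at h ⊢ <;> push_cast <;> linarith

theorem quarterEmb_mem_A15plus (m : Fin 16 → ℤ) :
    quarterEmb m ∈ A15plus ↔
      ∑ i, m i = 0 ∧ ∃ k : Fin 4, ∀ i, (4 : ℤ) ∣ m i - ((k : ℕ) : ℤ) := by
  refine and_congr ?_ (exists_congr fun k => forall_congr' fun i => ?_)
  · simp only [quarterEmb_apply, ← Finset.sum_div]
    rw [div_eq_zero_iff]
    norm_num
    norm_cast
  · rw [quarterEmb_apply, glueA15]
    split_ifs
    · refine exists_congr fun n => ?_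
      rw [← Int.cast_inj (α := ℝ)]
      push_cast
      constructor <;> intro h <;> linarith
    · rw [show (m i - ((k : ℕ) : ℤ)) = (m i + 3 * ((k : ℕ) : ℤ)) + 4 * -((k : ℕ) : ℤ) by ring,
        dvd_add_left (dvd_mul_right _ _)]
      refine exists_congr fun n => ?_
      rw [← Int.cast_inj (α := ℝ)]
      push_cast
      constructor <;> intro h <;> linarith

theorem prod_gaussMod (y : ℝ) (m : Fin 16 → ℤ) (c : ℤ) (h : ∀ i, 4 ∣ m i - c) :
    ∏ i, gaussMod y c (m i) = ENNReal.ofReal (Real.exp (-π * y * ‖quarterEmb m‖ ^ 2)) := by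
  simp only [gaussMod, if_pos (h _)]
  rw [← ENNReal.ofReal_prod_of_nonneg fun _ _ => Real.exp_nonneg _, ← Real.exp_sum,
    ← Finset.mul_sum, EuclideanSpace.norm_sq_eq]
  simp only [Real.norm_eq_abs, sq_abs, quarterEmb_apply]

theorem prod_gaussMod_eq_zero (y : ℝ) (m : Fin 16 → ℤ) (c : ℤ) (h : ¬ ∀ i, 4 ∣ m i - c) :
    ∏ i, gaussMod y c (m i) = 0 := by
  push Not at h
  obtain ⟨i, hi⟩ := h
  exact Finset.prod_eq_zero (Finset.mem_univ i) (if_neg hi)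

theorem tsum_A15plus (y : ℝ) :
    ∑' x : A15plus, ENNReal.ofReal (Real.exp (-π * y * ‖(x : EuclideanSpace ℝ (Fin 16))‖ ^ 2)) =
      ∑ k : Fin 4, (gaussMod y ((k : ℕ) : ℤ) ^ 16) 0 := by
  rw [tsum_subtype A15plus fun x => ENNReal.ofReal (Real.exp (-π * y * ‖x‖ ^ 2)),
    ← quarterEmb_injective.tsum_eq
      (Set.support_indicator_subset.trans A15plus_subset_range)]
  simp only [ConvSeq.pow_apply]
  rw [← Summable.tsum_finsetSum fun _ _ => ENNReal.summable]
  refine tsum_congr fun m => ?_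
  by_cases hm : quarterEmb m ∈ A15plus
  · rw [Set.indicator_of_mem hm]
    obtain ⟨h0, k, hk⟩ := (quarterEmb_mem_A15plus m).1 hm
    rw [Finset.sum_eq_single k, if_pos h0, prod_gaussMod y m _ hk]
    · intro j _ hjk
      rw [if_pos h0]
      refine prod_gaussMod_eq_zero y m _ fun hj => hjk ?_
      have h1 := hj 0
      have h2 := hk 0
      ext
      omega
    · simp
  · rw [Set.indicator_of_notMem hm]
    refine (Finset.sum_eq_zero fun k _ => ?_).symm
    rw [quarterEmb_mem_A15plus] at hm
    split_ifs with h0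
    · exact prod_gaussMod_eq_zero y m _ fun h => hm ⟨h0, k, h⟩
    · rfl

/-- The theta series of A₁₅⁺ on the imaginary axis equals θ₃(y)¹⁵ − 30 θ₃(y)⁷ Δ₈(y). -/
theorem theta_series_A15plus (y : ℝ) (hy : 0 < y) :
    (∑' x : A15plus, Real.exp (-π * y * ‖(x : EuclideanSpace ℝ (Fin 16))‖^2)) =
      theta3 y ^ 15 - 30 * theta3 y ^ 7 * Delta8 y := by
  have h4 : 2 * (2 * y) = 4 * y := by ring
  have hs : thetaMod (4 * y) 0 = ENNReal.ofReal (theta3 (4 * y)) := by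
    rw [theta3_eq, ENNReal.ofReal_toReal (thetaMod_ne_top _ (by positivity) _)]
  have ht : thetaMod (4 * y) 2 = ENNReal.ofReal (theta2 (4 * y)) := by
    rw [theta2_eq, ENNReal.ofReal_toReal (thetaMod_ne_top _ (by positivity) _)]
  have h2 : theta2 y ^ 4 = 8 * theta3 (4 * y) * theta2 (4 * y) *
      (theta3 (4 * y) ^ 2 + theta2 (4 * y) ^ 2) := by
    rw [show theta2 y ^ 4 = (theta2 y ^ 2) ^ 2 by ring, theta2_sq y, mul_pow, mul_pow,
      theta2_sq (2 * y), theta3_sq (2 * y) (by positivity), h4]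
    ring
  have hs0 : 0 ≤ theta3 (4 * y) := by rw [theta3_eq]; exact ENNReal.toReal_nonneg
  have ht0 : 0 ≤ theta2 (4 * y) := by rw [theta2_eq]; exact ENNReal.toReal_nonneg
  have hsum := congrArg ENNReal.toReal
    ((tsum_A15plus y).trans (sum_gaussMod_pow_sixteen_zero y _ _ hs.symm ht.symm))
  rw [ENNReal.tsum_toReal_eq fun _ => ENNReal.ofReal_ne_top] at hsum
  simp only [ENNReal.toReal_ofReal (Real.exp_nonneg _)] at hsum
  rw [hsum, Delta8, h2, theta4_eq_sub y hy, theta3_eq_add y hy]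
  generalize theta3 (4 * y) = s at *
  generalize theta2 (4 * y) = t at *
  lift s to NNReal using hs0
  lift t to NNReal using ht0
  simp only [ENNReal.ofReal_coe_nnreal]
  norm_cast
  rw [ENNReal.coe_toReal]
  push_cast
  ring
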